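/- arXiv:2510.03507 — 6 statements merged into one kernel-verified Lean document; each statement's English description precedes it below -/
import Mathlib

section
/- Let E be a real inner product space, n ≥ 1 a natural number, η ∈ (0,1) and δ ∈ [0,1] real numbers. Suppose for each i ∈ {1,…,n} we are given vectors e_i, e'_i, Δ_i, δ_i ∈ E such that e'_i = Δ_i − δ_i + (1−η)·e_i, and suppose (1/n)∑_{i=1}^n ‖Δ_i − δ_i‖² ≤ (1−δ)·(1/n)∑_{i=1}^n ‖δ_i‖². Then (1/n)∑_{i=1}^n ‖e'_i‖² ≤ (1−η)·(1/n)∑_{i=1}^n ‖e_i‖² + ((1−δ)/η)·(1/n)∑_{i=1}^n ‖δ_i‖². -/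
/-- One-step descent inequality for the averaged squared error term of EControl. -/
theorem e_descent_step {E : Type*} [NormedAddCommGroup E] [InnerProductSpace ℝ E]
    (n : ℕ) (hn : 1 ≤ n) (η δ : ℝ) (hη0 : 0 < η) (hη1 : η < 1)
    (hδ0 : 0 ≤ δ) (hδ1 : δ ≤ 1)
    (e e' Δ d : Fin n → E)
    (hrec : ∀ i, e' i = Δ i - d i + (1 - η) • e i)
    (hcomp : (1 / (n : ℝ)) * ∑ i, ‖Δ i - d i‖ ^ 2 ≤
      (1 - δ) * ((1 / (n : ℝ)) * ∑ i, ‖d i‖ ^ 2)) :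
    (1 / (n : ℝ)) * ∑ i, ‖e' i‖ ^ 2 ≤
      (1 - η) * ((1 / (n : ℝ)) * ∑ i, ‖e i‖ ^ 2) +
        ((1 - δ) / η) * ((1 / (n : ℝ)) * ∑ i, ‖d i‖ ^ 2) := by
  have key : ∀ i, ‖e' i‖ ^ 2 ≤ (1 - η) * ‖e i‖ ^ 2 + (1 / η) * ‖Δ i - d i‖ ^ 2 := by
    intro i
    have h1 : ‖e' i‖ ≤ ‖Δ i - d i‖ + (1 - η) * ‖e i‖ := by
      rw [hrec i]
      refine (norm_add_le _ _).trans ?_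
      rw [norm_smul, Real.norm_of_nonneg (by linarith)]
    have h2 : ‖e' i‖ ^ 2 ≤ (‖Δ i - d i‖ + (1 - η) * ‖e i‖) ^ 2 :=
      pow_le_pow_left₀ (norm_nonneg _) h1 2
    have h3 : 0 ≤ (1 - η) / η * (‖Δ i - d i‖ - η * ‖e i‖) ^ 2 :=
      mul_nonneg (div_nonneg (by linarith) hη0.le) (sq_nonneg _)
    have h4 : (1 - η) * ‖e i‖ ^ 2 + (1 / η) * ‖Δ i - d i‖ ^ 2
        = (‖Δ i - d i‖ + (1 - η) * ‖e i‖) ^ 2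
          + (1 - η) / η * (‖Δ i - d i‖ - η * ‖e i‖) ^ 2 := by
      field_simp
      ring
    linarith
  have hsum : ∑ i, ‖e' i‖ ^ 2 ≤
      (1 - η) * ∑ i, ‖e i‖ ^ 2 + (1 / η) * ∑ i, ‖Δ i - d i‖ ^ 2 := by
    rw [Finset.mul_sum, Finset.mul_sum, ← Finset.sum_add_distrib]
    exact Finset.sum_le_sum fun i _ => key i
  have hn0 : (0 : ℝ) ≤ 1 / (n : ℝ) := by positivity
  have h5 := mul_le_mul_of_nonneg_left hsum hn0
  have h6 := mul_le_mul_of_nonneg_left hcomp (one_div_pos.mpr hη0).le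
  refine h5.trans (le_of_eq_of_le (by ring) (add_le_add_right h6 ((1 - η) * ((1 / (n : ℝ)) * ∑ i, ‖e i‖ ^ 2))) |>.trans (le_of_eq (by ring)))
end

section
/- Let E be a real inner product space, n ≥ 1 a natural number, η ∈ (0,1) and δ ∈ [0,1] real numbers, and T ≥ 1 a natural number. Suppose for each t ∈ {0,…,T} and i ∈ {1,…,n} we are given vectors e_t^i, Δ_t^i, δ_t^i ∈ E such that e_0^i = 0, e_{t+1}^i = Δ_t^i − δ_t^i + (1−η)·e_t^i for all 0 ≤ t ≤ T−1, and (1/n)∑_{i=1}^n ‖Δ_t^i − δ_t^i‖² ≤ (1−δ)·(1/n)∑_{i=1}^n ‖δ_t^i‖² for all 0 ≤ t ≤ T−1. Define Ē_t := (1/n)∑_{i=1}^n ‖e_t^i‖² and H_t := (1/n)∑_{i=1}^n ‖δ_t^i‖². Then ∑_{t=1}^{T} Ē_t ≤ ((1−δ)/η²)·∑_{t=0}^{T−1} H_t. -/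
/-- Summed error descent for EControl: the cumulative averaged squared error
`Ē_t` is controlled by the cumulative averaged squared compression residual `H_t`. -/
theorem e_descent_sum_in_h {E : Type*} [NormedAddCommGroup E] [InnerProductSpace ℝ E]
    (n : ℕ) (hn : 1 ≤ n) (η δ : ℝ) (hη0 : 0 < η) (hη1 : η < 1)
    (hδ0 : 0 ≤ δ) (hδ1 : δ ≤ 1)
    (T : ℕ) (hT : 1 ≤ T)
    (e Δ d : ℕ → Fin n → E)
    (hinit : ∀ i, e 0 i = 0)
    (hrec : ∀ t, t < T → ∀ i, e (t + 1) i = Δ t i - d t i + (1 - η) • e t i)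
    (hcomp : ∀ t, t < T →
      (1 / (n : ℝ)) * ∑ i, ‖Δ t i - d t i‖ ^ 2 ≤
        (1 - δ) * ((1 / (n : ℝ)) * ∑ i, ‖d t i‖ ^ 2)) :
    ∑ t ∈ Finset.Icc 1 T, (1 / (n : ℝ)) * ∑ i, ‖e t i‖ ^ 2 ≤
      ((1 - δ) / η ^ 2) * ∑ t ∈ Finset.range T, (1 / (n : ℝ)) * ∑ i, ‖d t i‖ ^ 2 := by
  have hpt : ∀ t, t < T → ∀ i, η * ‖e (t + 1) i‖ ^ 2 ≤
      ‖Δ t i - d t i‖ ^ 2 + η * (1 - η) * ‖e t i‖ ^ 2 := by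
    intro t ht i
    have h1 : ‖e (t + 1) i‖ ≤ ‖Δ t i - d t i‖ + (1 - η) * ‖e t i‖ := by
      rw [hrec t ht i]
      refine (norm_add_le _ _).trans ?_
      rw [norm_smul, Real.norm_of_nonneg (by linarith)]
    have h2 := pow_le_pow_left₀ (norm_nonneg _) h1 2
    have h3 := mul_le_mul_of_nonneg_left h2 hη0.le
    have h4 := mul_nonneg (sub_nonneg.2 hη1.le) (sq_nonneg (‖Δ t i - d t i‖ - η * ‖e t i‖))
    nlinarith [h3, h4]
  have hstep : ∀ t, t < T → η * ((1 / (n : ℝ)) * ∑ i, ‖e (t + 1) i‖ ^ 2) ≤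
      (1 - δ) * ((1 / (n : ℝ)) * ∑ i, ‖d t i‖ ^ 2)
        + η * (1 - η) * ((1 / (n : ℝ)) * ∑ i, ‖e t i‖ ^ 2) := by
    intro t ht
    have h1 := Finset.sum_le_sum (fun i (_ : i ∈ Finset.univ) => hpt t ht i)
    rw [Finset.sum_add_distrib, ← Finset.mul_sum, ← Finset.mul_sum] at h1
    have h2 := mul_le_mul_of_nonneg_left h1 (show (0 : ℝ) ≤ 1 / (n : ℝ) by positivity)
    have h3 := hcomp t ht
    linarith
  have h0 : (1 / (n : ℝ)) * ∑ i, ‖e 0 i‖ ^ 2 = 0 := by simp [hinit]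
  have hnn : ∀ t, 0 ≤ (1 / (n : ℝ)) * ∑ i, ‖e t i‖ ^ 2 := fun t => by positivity
  generalize hA : (fun t => (1 / (n : ℝ)) * ∑ i, ‖e t i‖ ^ 2) = A at *
  generalize hH : (fun t => (1 / (n : ℝ)) * ∑ i, ‖d t i‖ ^ 2) = H at *
  have hA' : ∀ t, (1 / (n : ℝ)) * ∑ i, ‖e t i‖ ^ 2 = A t := fun t => congrFun hA t
  have hH' : ∀ t, (1 / (n : ℝ)) * ∑ i, ‖d t i‖ ^ 2 = H t := fun t => congrFun hH t
  simp only [hA', hH'] at *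
  have key : ∀ k, k ≤ T → η ^ 2 * ∑ t ∈ Finset.Icc 1 k, A t + η * (1 - η) * A k ≤
      (1 - δ) * ∑ t ∈ Finset.range k, H t := by
    intro k
    induction k with
    | zero => intro _; simp [h0]
    | succ k ih =>
      intro hk
      have h1 := ih (by omega)
      have h2 := hstep k (by omega)
      rw [Finset.sum_Icc_succ_top (by omega), Finset.sum_range_succ]
      linarith
  have h1 := key T le_rfl
  have h2 : 0 ≤ η * (1 - η) * A T :=
    mul_nonneg (mul_nonneg hη0.le (by linarith)) (hnn T)
  rw [div_mul_eq_mul_div, le_div_iff₀ (by positivity)]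
  linarith
end

section
/- Let E be a real inner product space, n ≥ 1 a natural number, δ ∈ (0,1) a real number, δ'' := δ/(4−3δ), and 0 ≤ η ≤ δ''/(√(1+δ'') + 1). Suppose for each i ∈ {1,…,n} we are given vectors δ_i, δ'_i, Δ_i, e_i, p_i, m_i, q_i ∈ E such that δ'_i = (1+η)·(δ_i − Δ_i) + η²·e_i + (m_i + p_i − q_i), and suppose (1/n)∑_{i=1}^n ‖δ_i − Δ_i‖² ≤ (1−δ)·(1/n)∑_{i=1}^n ‖δ_i‖². Then (1/n)∑_{i=1}^n ‖δ'_i‖² ≤ (1 − δ/2)·(1/n)∑_{i=1}^n ‖δ_i‖² + ((16−12δ)/δ)·( η⁴·(1/n)∑_{i=1}^n ‖e_i‖² + (1/n)∑_{i=1}^n ‖p_i‖² + (1/n)∑_{i=1}^n ‖m_i‖² + (1/n)∑_{i=1}^n ‖q_i‖² ). -/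
theorem young_five (β a x y z w : ℝ) (hβ : 0 < β) :
    (a + (x + y + z + w)) ^ 2 ≤
      (1 + β) * a ^ 2 + (1 + 1 / β) * (4 * (x ^ 2 + y ^ 2 + z ^ 2 + w ^ 2)) := by
  have h4 : (x + y + z + w) ^ 2 ≤ 4 * (x ^ 2 + y ^ 2 + z ^ 2 + w ^ 2) := by
    nlinarith [sq_nonneg (x - y), sq_nonneg (x - z), sq_nonneg (x - w), sq_nonneg (y - z),
      sq_nonneg (y - w), sq_nonneg (z - w)]
  have h5 : (1 + 1 / β) * (x + y + z + w) ^ 2 ≤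
      (1 + 1 / β) * (4 * (x ^ 2 + y ^ 2 + z ^ 2 + w ^ 2)) :=
    mul_le_mul_of_nonneg_left h4 (by positivity)
  have h6 : 0 ≤ (β * a - (x + y + z + w)) ^ 2 / β := by positivity
  have h7 : (β * a - (x + y + z + w)) ^ 2 / β =
      (1 + β) * a ^ 2 + (1 + 1 / β) * (x + y + z + w) ^ 2 - (a + (x + y + z + w)) ^ 2 := by
    field_simp
    ring
  linarith

/-- One-step descent inequality for the averaged squared compression residual. -/
theorem h_descent_step {E : Type*} [NormedAddCommGroup E] [InnerProductSpace ℝ E]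
    (n : ℕ) (hn : 1 ≤ n) (δ η : ℝ) (hδ0 : 0 < δ) (hδ1 : δ < 1)
    (hη0 : 0 ≤ η)
    (hη : η ≤ (δ / (4 - 3 * δ)) / (Real.sqrt (1 + δ / (4 - 3 * δ)) + 1))
    (d d' Δ e p m q : Fin n → E)
    (hrec : ∀ i, d' i = (1 + η) • (d i - Δ i) + (η ^ 2) • e i + (m i + p i - q i))
    (hcomp : (1 / (n : ℝ)) * ∑ i, ‖d i - Δ i‖ ^ 2 ≤
      (1 - δ) * ((1 / (n : ℝ)) * ∑ i, ‖d i‖ ^ 2)) :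
    (1 / (n : ℝ)) * ∑ i, ‖d' i‖ ^ 2 ≤
      (1 - δ / 2) * ((1 / (n : ℝ)) * ∑ i, ‖d i‖ ^ 2) +
        ((16 - 12 * δ) / δ) *
          (η ^ 4 * ((1 / (n : ℝ)) * ∑ i, ‖e i‖ ^ 2) +
            (1 / (n : ℝ)) * ∑ i, ‖p i‖ ^ 2 +
            (1 / (n : ℝ)) * ∑ i, ‖m i‖ ^ 2 +
            (1 / (n : ℝ)) * ∑ i, ‖q i‖ ^ 2) := by
  have h43 : 0 < 4 - 3 * δ := by linarith
  have h1 : 0 < 1 - δ := by linarith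
  have hsq : (1 + η) ^ 2 ≤ 1 + δ / (4 - 3 * δ) := by
    have hr : 0 ≤ δ / (4 - 3 * δ) := by positivity
    generalize δ / (4 - 3 * δ) = r at hη hr
    have hs := Real.sq_sqrt (show 0 ≤ 1 + r by linarith)
    have hs0 := Real.sqrt_nonneg (1 + r)
    rw [le_div_iff₀ (by linarith)] at hη
    generalize Real.sqrt (1 + r) = s at *
    have : η ≤ s - 1 := by
      have : 0 ≤ (s - 1 - η) * (s + 1) := by nlinarith
      have := nonneg_of_mul_nonneg_left this (by linarith)
      linarith
    nlinarith
  have hC : (1 + 1 / (δ / (4 * (1 - δ)))) * 4 = (16 - 12 * δ) / δ := by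
    field_simp
    ring
  have hA : (1 + δ / (4 * (1 - δ))) * (1 + η) ^ 2 * (1 - δ) ≤ 1 - δ / 2 := by
    have e1 : (1 + δ / (4 * (1 - δ))) * (1 + δ / (4 - 3 * δ)) * (1 - δ) = 1 - δ / 2 := by
      have a1 : 1 + δ / (4 - 3 * δ) = (4 - 2 * δ) / (4 - 3 * δ) := by
        rw [eq_div_iff h43.ne', add_mul, div_mul_cancel₀ _ h43.ne']
        ring
      have a2 : (1 + δ / (4 * (1 - δ))) * (1 - δ) = (4 - 3 * δ) / 4 := by
        field_simp
        ring
      rw [mul_right_comm, a2, a1, div_mul_div_comm, mul_comm (4 - 3 * δ),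
        mul_div_mul_right _ _ h43.ne']
      ring
    rw [← e1]
    gcongr
  have hβ : 0 < δ / (4 * (1 - δ)) := by positivity
  generalize δ / (4 * (1 - δ)) = β at *
  have hpt : ∀ i, ‖d' i‖ ^ 2 ≤ (1 + β) * (1 + η) ^ 2 * ‖d i - Δ i‖ ^ 2 +
      (16 - 12 * δ) / δ * (η ^ 4 * ‖e i‖ ^ 2 + ‖p i‖ ^ 2 + ‖m i‖ ^ 2 + ‖q i‖ ^ 2) := by
    intro i
    have hn1 : ‖d' i‖ ≤ (1 + η) * ‖d i - Δ i‖ + (η ^ 2 * ‖e i‖ + ‖p i‖ + ‖m i‖ + ‖q i‖) := by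
      rw [hrec i]
      have t1 := norm_add_le ((1 + η) • (d i - Δ i) + (η ^ 2) • e i) (m i + p i - q i)
      have t2 := norm_add_le ((1 + η) • (d i - Δ i)) ((η ^ 2) • e i)
      have t3 := norm_sub_le (m i + p i) (q i)
      have t4 := norm_add_le (m i) (p i)
      rw [norm_smul, norm_smul, Real.norm_of_nonneg (by positivity),
        Real.norm_of_nonneg (by positivity)] at t2
      linarith
    have hn2 := pow_le_pow_left₀ (norm_nonneg _) hn1 2
    have hy := young_five β ((1 + η) * ‖d i - Δ i‖) (η ^ 2 * ‖e i‖) ‖p i‖ ‖m i‖ ‖q i‖ hβ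
    refine (hn2.trans hy).trans (le_of_eq ?_)
    rw [← hC]
    ring
  have hsum := Finset.sum_le_sum (fun i (_ : i ∈ Finset.univ) => hpt i)
  simp only [Finset.sum_add_distrib, ← Finset.mul_sum] at hsum
  have hn0 : 0 ≤ 1 / (n : ℝ) := by positivity
  have hS := mul_le_mul_of_nonneg_left hsum hn0
  have hc2 := mul_le_mul_of_nonneg_left hcomp (show 0 ≤ (1 + β) * (1 + η) ^ 2 by positivity)
  have hD : 0 ≤ (1 / (n : ℝ)) * ∑ i, ‖d i‖ ^ 2 := by positivity
  have hc3 := mul_le_mul_of_nonneg_right hA hD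
  linarith
end

section
/- Let ℓ > 0, L ≥ 0, R₀ > 0, σ ≥ 0, F₀ ≥ 0 be real numbers, δ ∈ (0,1], n ≥ 1 and T ≥ 1 natural numbers, and define γ := max{ 28ℓ/δ, 14·L^{1/4}·ℓ^{1/2}·F₀^{1/4}/(δ·R₀^{1/2}), √(2Tσ²/(nR₀²)), 32·T^{1/3}·L^{1/3}·σ^{2/3}/(R₀^{2/3}·δ^{4/3}) }. Then γ·R₀²/(2T) + 2^{15}·ℓ²·L·F₀/(γ³·δ⁴·T) + 2^{14}·L·σ²/(γ²·δ⁴) + σ²/(γ·n) ≤ 14·ℓ·R₀²/(δT) + 19·L^{1/4}·ℓ^{1/2}·F₀^{1/4}·R₀^{3/2}/(δT) + √(2R₀²σ²/(nT)) + 32·R₀^{4/3}·L^{1/3}·σ^{2/3}/(T^{2/3}·δ^{4/3}). -/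
/-- Step-size optimization for the main convergence theorem of EControl (dual averaging). -/
theorem stepsize_optimization (ℓ L R₀ σ F₀ δ : ℝ) (n T : ℕ)
    (hℓ : 0 < ℓ) (hL : 0 ≤ L) (hR : 0 < R₀) (hσ : 0 ≤ σ) (hF : 0 ≤ F₀)
    (hδ0 : 0 < δ) (hδ1 : δ ≤ 1) (hn : 1 ≤ n) (hT : 1 ≤ T)
    (γ : ℝ)
    (hγ : γ = max (max (max (28 * ℓ / δ)
        (14 * L ^ ((1 : ℝ) / 4) * ℓ ^ ((1 : ℝ) / 2) * F₀ ^ ((1 : ℝ) / 4) /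
          (δ * R₀ ^ ((1 : ℝ) / 2))))
        (Real.sqrt (2 * T * σ ^ 2 / (n * R₀ ^ 2))))
        (32 * (T : ℝ) ^ ((1 : ℝ) / 3) * L ^ ((1 : ℝ) / 3) * σ ^ ((2 : ℝ) / 3) /
          (R₀ ^ ((2 : ℝ) / 3) * δ ^ ((4 : ℝ) / 3)))) :
    γ * R₀ ^ 2 / (2 * T) + 2 ^ 15 * ℓ ^ 2 * L * F₀ / (γ ^ 3 * δ ^ 4 * T) +
        2 ^ 14 * L * σ ^ 2 / (γ ^ 2 * δ ^ 4) + σ ^ 2 / (γ * n) ≤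
      14 * ℓ * R₀ ^ 2 / (δ * T) +
        19 * L ^ ((1 : ℝ) / 4) * ℓ ^ ((1 : ℝ) / 2) * F₀ ^ ((1 : ℝ) / 4) *
          R₀ ^ ((3 : ℝ) / 2) / (δ * T) +
        Real.sqrt (2 * R₀ ^ 2 * σ ^ 2 / (n * T)) +
        32 * R₀ ^ ((4 : ℝ) / 3) * L ^ ((1 : ℝ) / 3) * σ ^ ((2 : ℝ) / 3) /
          ((T : ℝ) ^ ((2 : ℝ) / 3) * δ ^ ((4 : ℝ) / 3)) := by
  have hT0 : (0 : ℝ) < T := by exact_mod_cast hT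
  have hn0 : (0 : ℝ) < n := by exact_mod_cast hn
  set a := 28 * ℓ / δ with ha
  set b := 14 * L ^ ((1 : ℝ) / 4) * ℓ ^ ((1 : ℝ) / 2) * F₀ ^ ((1 : ℝ) / 4) /
          (δ * R₀ ^ ((1 : ℝ) / 2)) with hb
  set c := Real.sqrt (2 * T * σ ^ 2 / (n * R₀ ^ 2)) with hc
  set d := 32 * (T : ℝ) ^ ((1 : ℝ) / 3) * L ^ ((1 : ℝ) / 3) * σ ^ ((2 : ℝ) / 3) /
          (R₀ ^ ((2 : ℝ) / 3) * δ ^ ((4 : ℝ) / 3)) with hd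
  have ha0 : 0 < a := by positivity
  have hb0 : 0 ≤ b := by positivity
  have hc0 : 0 ≤ c := by positivity
  have hd0 : 0 ≤ d := by positivity
  have hag : a ≤ γ := by rw [hγ]; simp
  have hbg : b ≤ γ := by rw [hγ]; simp
  have hcg : c ≤ γ := by rw [hγ]; simp
  have hdg : d ≤ γ := by rw [hγ]; simp
  have hg0 : 0 < γ := ha0.trans_le hag
  have hsum : γ ≤ a + b + c + d := by
    rw [hγ]
    refine max_le (max_le (max_le ?_ ?_) ?_) ?_ <;> linarith
  have key : ∀ (x p q : ℝ) (m : ℕ), 0 ≤ x → p * m = q →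
      (x ^ p) ^ m = x ^ q := by
    intro x p q m hx h
    rw [← Real.rpow_natCast, ← Real.rpow_mul hx, h]
  have b4 : b ^ 4 = 14 ^ 4 * L * ℓ ^ 2 * F₀ / (δ ^ 4 * R₀ ^ 2) := by
    rw [hb, div_pow, mul_pow, mul_pow, mul_pow, mul_pow,
      key L _ 1 4 hL (by norm_num), key ℓ _ (2 : ℕ) 4 hℓ.le (by norm_num),
      key F₀ _ 1 4 hF (by norm_num), key R₀ _ (2 : ℕ) 4 hR.le (by norm_num)]
    simp only [Real.rpow_one, Real.rpow_natCast]
  have c2 : c ^ 2 = 2 * T * σ ^ 2 / (n * R₀ ^ 2) := Real.sq_sqrt (by positivity)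
  have d3 : d ^ 3 = 32 ^ 3 * T * L * σ ^ 2 / (R₀ ^ 2 * δ ^ 4) := by
    rw [hd, div_pow, mul_pow, mul_pow, mul_pow, mul_pow,
      key L _ 1 3 hL (by norm_num), key σ _ (2 : ℕ) 3 hσ (by norm_num),
      key T _ 1 3 hT0.le (by norm_num), key R₀ _ (2 : ℕ) 3 hR.le (by norm_num),
      key δ _ (4 : ℕ) 3 hδ0.le (by norm_num)]
    simp only [Real.rpow_one, Real.rpow_natCast]
  set u := R₀ ^ 2 / (2 * T) with hu
  have hu0 : 0 < u := by positivity
  have e1 : γ * R₀ ^ 2 / (2 * T) = γ * u := by rw [hu]; ring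
  have e2 : 2 ^ 15 * ℓ ^ 2 * L * F₀ / (γ ^ 3 * δ ^ 4 * T)
      = 2 ^ 16 / 14 ^ 4 * (b ^ 4 / γ ^ 3) * u := by
    rw [b4, hu]; field_simp; try ring
  have e3 : 2 ^ 14 * L * σ ^ 2 / (γ ^ 2 * δ ^ 4) = d ^ 3 / γ ^ 2 * u := by
    rw [d3, hu]; field_simp; try ring
  have e4 : σ ^ 2 / (γ * n) = c ^ 2 / γ * u := by
    rw [c2, hu]; field_simp
  have f1 : 14 * ℓ * R₀ ^ 2 / (δ * T) = a * u := by
    rw [ha, hu]; field_simp; try ring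
  have r1 : R₀ ^ ((3 : ℝ) / 2) * R₀ ^ ((1 : ℝ) / 2) = R₀ ^ 2 := by
    rw [← Real.rpow_add hR, ← Real.rpow_natCast]; norm_num
  have r2 : R₀ ^ ((4 : ℝ) / 3) * R₀ ^ ((2 : ℝ) / 3) = R₀ ^ 2 := by
    rw [← Real.rpow_add hR, ← Real.rpow_natCast]; norm_num
  have r3 : (T : ℝ) ^ ((1 : ℝ) / 3) * (T : ℝ) ^ ((2 : ℝ) / 3) = T := by
    rw [← Real.rpow_add hT0]; norm_num
  have f2 : 19 * L ^ ((1 : ℝ) / 4) * ℓ ^ ((1 : ℝ) / 2) * F₀ ^ ((1 : ℝ) / 4) *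
          R₀ ^ ((3 : ℝ) / 2) / (δ * T) = 19 / 7 * b * u := by
    have hp : 0 < R₀ ^ ((1 : ℝ) / 2) := by positivity
    rw [hb, hu, ← r1]
    generalize R₀ ^ ((1 : ℝ) / 2) = y at *
    generalize R₀ ^ ((3 : ℝ) / 2) = z at *
    generalize L ^ ((1 : ℝ) / 4) = l at *
    generalize ℓ ^ ((1 : ℝ) / 2) = l' at *
    generalize F₀ ^ ((1 : ℝ) / 4) = f at *
    field_simp
    ring
  have f3 : Real.sqrt (2 * R₀ ^ 2 * σ ^ 2 / (n * T)) = 2 * c * u := by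
    rw [Real.sqrt_eq_iff_mul_self_eq (by positivity) (by positivity)]
    have : 2 * c * u * (2 * c * u) = 4 * c ^ 2 * u ^ 2 := by ring
    rw [this, c2, hu]
    field_simp
    ring
  have f4 : 32 * R₀ ^ ((4 : ℝ) / 3) * L ^ ((1 : ℝ) / 3) * σ ^ ((2 : ℝ) / 3) /
          ((T : ℝ) ^ ((2 : ℝ) / 3) * δ ^ ((4 : ℝ) / 3)) = 2 * d * u := by
    have hp : 0 < R₀ ^ ((2 : ℝ) / 3) := by positivity
    have hp1 : 0 < (T : ℝ) ^ ((1 : ℝ) / 3) := by positivity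
    have hp2 : 0 < (T : ℝ) ^ ((2 : ℝ) / 3) := by positivity
    have hp3 : 0 < δ ^ ((4 : ℝ) / 3) := by positivity
    have hu' : u = R₀ ^ ((4 : ℝ) / 3) * R₀ ^ ((2 : ℝ) / 3) /
        (2 * ((T : ℝ) ^ ((1 : ℝ) / 3) * (T : ℝ) ^ ((2 : ℝ) / 3))) := by rw [r2, r3]
    rw [hd, hu']
    clear_value u d c b a
    clear r1 r2 r3 hu' hd
    generalize R₀ ^ ((2 : ℝ) / 3) = y at *
    generalize R₀ ^ ((4 : ℝ) / 3) = z at *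
    generalize (T : ℝ) ^ ((1 : ℝ) / 3) = t at *
    generalize (T : ℝ) ^ ((2 : ℝ) / 3) = t' at *
    generalize δ ^ ((4 : ℝ) / 3) = e at *
    field_simp
  have g2 : b ^ 4 / γ ^ 3 ≤ b := by
    rw [div_le_iff₀ (by positivity), pow_succ' b 3]
    gcongr
  have g3 : d ^ 3 / γ ^ 2 ≤ d := by
    rw [div_le_iff₀ (by positivity), pow_succ' d 2]
    gcongr
  have g4 : c ^ 2 / γ ≤ c := by
    rw [div_le_iff₀ (by positivity), pow_two]
    gcongr
  rw [e1, e2, e3, e4, f1, f2, f3, f4, ← add_mul, ← add_mul, ← add_mul, ← add_mul, ← add_mul,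
    ← add_mul]
  refine mul_le_mul_of_nonneg_right ?_ hu0.le
  norm_num
  linarith
end

section
/- Let ℓ > 0, L ≥ 0, R₀ > 0, σ ≥ 0 be real numbers, δ ∈ (0,1], n ≥ 1 and T ≥ 1 natural numbers, and define γ := max{ 28ℓ/δ, 16·(ℓL)^{1/2}/δ, 16·ℓ^{1/2}·L^{1/4}·σ^{1/4}/(δ·R₀^{1/4}), √(2Tσ²/(nR₀²)), 32·T^{1/3}·L^{1/3}·σ^{2/3}/(R₀^{2/3}·δ^{4/3}) }. Then γ·R₀²/(2T) + 2^{15}·ℓ²·L²·R₀²/(γ³·δ⁴·T) + 2^{15}·ℓ²·L·R₀·σ/(γ³·δ⁴·T) + 2^{14}·L·σ²/(γ²·δ⁴) + σ²/(γ·n) ≤ 14·ℓ·R₀²/(δT) + 16·(ℓL)^{1/2}·R₀²/(δT) + 16·ℓ^{1/2}·L^{1/4}·R₀^{7/4}·σ^{1/4}/(δT) + √(2R₀²σ²/(nT)) + 32·R₀^{4/3}·L^{1/3}·σ^{2/3}/(T^{2/3}·δ^{4/3}). -/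
theorem aux_pow (x g : ℝ) (k : ℕ) (hx : 0 ≤ x) (hg : 0 < g) (h : x ≤ g) :
    x ^ (k + 1) / g ^ k ≤ x := by
  rw [div_le_iff₀ (by positivity), pow_succ, mul_comm]
  exact mul_le_mul_of_nonneg_left (pow_le_pow_left₀ hx h k) hx

theorem aux_rpow (x p : ℝ) (k m : ℕ) (hx : 0 ≤ x) (h : p * k = m) :
    (x ^ p) ^ k = x ^ m := by
  rw [← Real.rpow_natCast, ← Real.rpow_mul hx, h, Real.rpow_natCast]

/-- Step-size optimization for the warm-start variant of the main convergence theorem. -/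
theorem stepsize_optimization_warm_start (ℓ L R₀ σ δ : ℝ) (n T : ℕ)
    (hℓ : 0 < ℓ) (hL : 0 ≤ L) (hR : 0 < R₀) (hσ : 0 ≤ σ)
    (hδ0 : 0 < δ) (hδ1 : δ ≤ 1) (hn : 1 ≤ n) (hT : 1 ≤ T)
    (γ : ℝ)
    (hγ : γ = max (max (max (max (28 * ℓ / δ)
        (16 * (ℓ * L) ^ ((1 : ℝ) / 2) / δ))
        (16 * ℓ ^ ((1 : ℝ) / 2) * L ^ ((1 : ℝ) / 4) * σ ^ ((1 : ℝ) / 4) /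
          (δ * R₀ ^ ((1 : ℝ) / 4))))
        (Real.sqrt (2 * T * σ ^ 2 / (n * R₀ ^ 2))))
        (32 * (T : ℝ) ^ ((1 : ℝ) / 3) * L ^ ((1 : ℝ) / 3) * σ ^ ((2 : ℝ) / 3) /
          (R₀ ^ ((2 : ℝ) / 3) * δ ^ ((4 : ℝ) / 3)))) :
    γ * R₀ ^ 2 / (2 * T) + 2 ^ 15 * ℓ ^ 2 * L ^ 2 * R₀ ^ 2 / (γ ^ 3 * δ ^ 4 * T) +
        2 ^ 15 * ℓ ^ 2 * L * R₀ * σ / (γ ^ 3 * δ ^ 4 * T) +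
        2 ^ 14 * L * σ ^ 2 / (γ ^ 2 * δ ^ 4) + σ ^ 2 / (γ * n) ≤
      14 * ℓ * R₀ ^ 2 / (δ * T) +
        16 * (ℓ * L) ^ ((1 : ℝ) / 2) * R₀ ^ 2 / (δ * T) +
        16 * ℓ ^ ((1 : ℝ) / 2) * L ^ ((1 : ℝ) / 4) * R₀ ^ ((7 : ℝ) / 4) *
          σ ^ ((1 : ℝ) / 4) / (δ * T) +
        Real.sqrt (2 * R₀ ^ 2 * σ ^ 2 / (n * T)) +
        32 * R₀ ^ ((4 : ℝ) / 3) * L ^ ((1 : ℝ) / 3) * σ ^ ((2 : ℝ) / 3) /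
          ((T : ℝ) ^ ((2 : ℝ) / 3) * δ ^ ((4 : ℝ) / 3)) := by
  have hT0 : (0 : ℝ) < T := by exact_mod_cast hT
  have hn0 : (0 : ℝ) < n := by exact_mod_cast hn
  have e2 : (16 * (ℓ * L) ^ ((1 : ℝ) / 2) / δ) ^ 4 = 2 ^ 16 * ℓ ^ 2 * L ^ 2 / δ ^ 4 := by
    rw [div_pow, mul_pow, aux_rpow (ℓ * L) _ 4 2 (by positivity) (by norm_num)]
    ring
  have e3 : (16 * ℓ ^ ((1 : ℝ) / 2) * L ^ ((1 : ℝ) / 4) * σ ^ ((1 : ℝ) / 4) /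
      (δ * R₀ ^ ((1 : ℝ) / 4))) ^ 4 = 2 ^ 16 * ℓ ^ 2 * L * σ / (δ ^ 4 * R₀) := by
    rw [div_pow, mul_pow, mul_pow, mul_pow, mul_pow,
      aux_rpow ℓ _ 4 2 hℓ.le (by norm_num), aux_rpow L _ 4 1 hL (by norm_num),
      aux_rpow σ _ 4 1 hσ (by norm_num), aux_rpow R₀ _ 4 1 hR.le (by norm_num)]
    norm_num
  have e4 : (Real.sqrt (2 * T * σ ^ 2 / (n * R₀ ^ 2))) ^ 2 = 2 * T * σ ^ 2 / (n * R₀ ^ 2) :=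
    Real.sq_sqrt (by positivity)
  have e5 : (32 * (T : ℝ) ^ ((1 : ℝ) / 3) * L ^ ((1 : ℝ) / 3) * σ ^ ((2 : ℝ) / 3) /
      (R₀ ^ ((2 : ℝ) / 3) * δ ^ ((4 : ℝ) / 3))) ^ 3 =
      2 ^ 15 * T * L * σ ^ 2 / (R₀ ^ 2 * δ ^ 4) := by
    rw [div_pow, mul_pow, mul_pow, mul_pow, mul_pow,
      aux_rpow T _ 3 1 hT0.le (by norm_num), aux_rpow L _ 3 1 hL (by norm_num),
      aux_rpow σ _ 3 2 hσ (by norm_num), aux_rpow R₀ _ 3 2 hR.le (by norm_num),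
      aux_rpow δ _ 3 4 hδ0.le (by norm_num)]
    norm_num
  have r3 : 16 * ℓ ^ ((1 : ℝ) / 2) * L ^ ((1 : ℝ) / 4) * R₀ ^ ((7 : ℝ) / 4) *
      σ ^ ((1 : ℝ) / 4) / (δ * T) = (16 * ℓ ^ ((1 : ℝ) / 2) * L ^ ((1 : ℝ) / 4) *
      σ ^ ((1 : ℝ) / 4) / (δ * R₀ ^ ((1 : ℝ) / 4))) * (R₀ ^ 2 / T) := by
    have h : R₀ ^ 2 = R₀ ^ ((7 : ℝ) / 4) * R₀ ^ ((1 : ℝ) / 4) := by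
      rw [← Real.rpow_add hR, ← Real.rpow_natCast]; norm_num
    rw [h]
    have : 0 < R₀ ^ ((1 : ℝ) / 4) := by positivity
    generalize R₀ ^ ((1 : ℝ) / 4) = y at *
    field_simp
  have r4 : Real.sqrt (2 * R₀ ^ 2 * σ ^ 2 / (n * T)) =
      Real.sqrt (2 * T * σ ^ 2 / (n * R₀ ^ 2)) * (R₀ ^ 2 / T) := by
    have hK : 0 ≤ R₀ ^ 2 / (T : ℝ) := by positivity
    rw [Real.sqrt_eq_iff_eq_sq (by positivity) (by positivity), mul_pow, e4]
    field_simp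
  have r5 : 32 * R₀ ^ ((4 : ℝ) / 3) * L ^ ((1 : ℝ) / 3) * σ ^ ((2 : ℝ) / 3) /
      ((T : ℝ) ^ ((2 : ℝ) / 3) * δ ^ ((4 : ℝ) / 3)) =
      (32 * (T : ℝ) ^ ((1 : ℝ) / 3) * L ^ ((1 : ℝ) / 3) * σ ^ ((2 : ℝ) / 3) /
      (R₀ ^ ((2 : ℝ) / 3) * δ ^ ((4 : ℝ) / 3))) * (R₀ ^ 2 / T) := by
    have h : R₀ ^ 2 = R₀ ^ ((4 : ℝ) / 3) * R₀ ^ ((2 : ℝ) / 3) := by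
      rw [← Real.rpow_add hR, ← Real.rpow_natCast]; norm_num
    have h' : (T : ℝ) = (T : ℝ) ^ ((2 : ℝ) / 3) * (T : ℝ) ^ ((1 : ℝ) / 3) := by
      rw [← Real.rpow_add hT0]; norm_num
    have hd : R₀ ^ 2 / (T : ℝ) = R₀ ^ ((4 : ℝ) / 3) * R₀ ^ ((2 : ℝ) / 3) /
      ((T : ℝ) ^ ((2 : ℝ) / 3) * (T : ℝ) ^ ((1 : ℝ) / 3)) := by rw [← h, ← h']
    rw [hd]
    have p1 : 0 < R₀ ^ ((2 : ℝ) / 3) := by positivity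
    have p2 : 0 < (T : ℝ) ^ ((2 : ℝ) / 3) := by positivity
    have p3 : 0 < (T : ℝ) ^ ((1 : ℝ) / 3) := by positivity
    have p4 : 0 < δ ^ ((4 : ℝ) / 3) := by positivity
    clear h h' hd e2 e3 e4 e5 r3 r4 hγ
    generalize R₀ ^ ((2 : ℝ) / 3) = y1 at *
    generalize (T : ℝ) ^ ((2 : ℝ) / 3) = y2 at *
    generalize (T : ℝ) ^ ((1 : ℝ) / 3) = y3 at *
    generalize δ ^ ((4 : ℝ) / 3) = y4 at *
    field_simp
  have r2 : 16 * (ℓ * L) ^ ((1 : ℝ) / 2) * R₀ ^ 2 / (δ * T) =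
      (16 * (ℓ * L) ^ ((1 : ℝ) / 2) / δ) * (R₀ ^ 2 / T) := by
    field_simp
  rw [r2, r3, r4, r5]
  have n2 : 0 ≤ 16 * (ℓ * L) ^ ((1 : ℝ) / 2) / δ := by positivity
  have n3 : 0 ≤ 16 * ℓ ^ ((1 : ℝ) / 2) * L ^ ((1 : ℝ) / 4) * σ ^ ((1 : ℝ) / 4) /
      (δ * R₀ ^ ((1 : ℝ) / 4)) := by positivity
  have n4 : 0 ≤ Real.sqrt (2 * T * σ ^ 2 / (n * R₀ ^ 2)) := by positivity
  have n5 : 0 ≤ 32 * (T : ℝ) ^ ((1 : ℝ) / 3) * L ^ ((1 : ℝ) / 3) * σ ^ ((2 : ℝ) / 3) /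
      (R₀ ^ ((2 : ℝ) / 3) * δ ^ ((4 : ℝ) / 3)) := by positivity
  clear r2 r3 r4 r5
  generalize 16 * (ℓ * L) ^ ((1 : ℝ) / 2) / δ = a2 at *
  generalize 16 * ℓ ^ ((1 : ℝ) / 2) * L ^ ((1 : ℝ) / 4) * σ ^ ((1 : ℝ) / 4) /
      (δ * R₀ ^ ((1 : ℝ) / 4)) = a3 at *
  generalize Real.sqrt (2 * T * σ ^ 2 / (n * R₀ ^ 2)) = a4 at *
  generalize 32 * (T : ℝ) ^ ((1 : ℝ) / 3) * L ^ ((1 : ℝ) / 3) * σ ^ ((2 : ℝ) / 3) /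
      (R₀ ^ ((2 : ℝ) / 3) * δ ^ ((4 : ℝ) / 3)) = a5 at *
  have n1 : 0 < 28 * ℓ / δ := by positivity
  have g1 : 28 * ℓ / δ ≤ γ := by rw [hγ]; simp
  have g2 : a2 ≤ γ := by rw [hγ]; simp
  have g3 : a3 ≤ γ := by rw [hγ]; simp
  have g4 : a4 ≤ γ := by rw [hγ]; simp
  have g5 : a5 ≤ γ := by rw [hγ]; simp
  have gs : γ ≤ 28 * ℓ / δ + a2 + a3 + a4 + a5 := by
    rw [hγ]
    refine max_le (max_le (max_le (max_le ?_ ?_) ?_) ?_) ?_ <;> linarith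
  have g0 : 0 < γ := lt_of_lt_of_le n1 g1
  have hK : 0 < R₀ ^ 2 / (T : ℝ) := by positivity
  have b2 := aux_pow a2 γ 3 n2 g0 g2
  have b3 := aux_pow a3 γ 3 n3 g0 g3
  have b4 := aux_pow a4 γ 1 n4 g0 g4
  have b5 := aux_pow a5 γ 2 n5 g0 g5
  norm_num only [e2, e3, e4, e5] at b2 b3 b4 b5
  have key : γ + a2 ^ 4 / γ ^ 3 + a3 ^ 4 / γ ^ 3 + a5 ^ 3 / γ ^ 2 + a4 ^ 2 / γ ^ 1 ≤
      28 * ℓ / δ + 2 * a2 + 2 * a3 + 2 * a4 + 2 * a5 := by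
    rw [e2, e3, e4, e5]
    norm_num only
    linarith
  have key2 := mul_le_mul_of_nonneg_right key (half_pos hK).le
  rw [e2, e3, e4, e5] at key2
  refine le_trans (le_of_eq ?_) (key2.trans (le_of_eq ?_))
  · clear key key2 b2 b3 b4 b5 gs g1 g2 g3 g4 g5 hγ e2 e3 e4 e5
    field_simp
    try ring
  · field_simp
    try ring
end

section
/- Let δ ∈ (0,1], ℓ > 0, L ≥ 0, σ ≥ 0, F ≥ 0 be real numbers, n ≥ 1 and T ≥ 2 natural numbers, η := δ/12, and γ a real number with γ ≥ 2L and γ ≥ 28ℓ/δ. Let (E_t)_{t=0}^{T}, (H_t)_{t=0}^{T−1}, (D_t)_{t=0}^{T−1} be nonnegative real sequences with E_0 = 0 satisfying: (A) ∑_{t=1}^{T} E_t ≤ ((1−δ)/η²)·∑_{t=0}^{T−1} H_t; (B) ∑_{t=0}^{T−1} H_t ≤ (32η⁴/δ²)·∑_{t=0}^{T−2} E_t + (32ℓ²/δ²)·∑_{t=0}^{T−2} D_t + 64Tσ²/δ²; (C) ((γ−L)/2)·∑_{t=0}^{T−1} D_t ≤ F + (3/(2γ))·∑_{t=0}^{T−1}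 ((1−δ)·H_t + η²·E_t) + 3Tσ²/(2γn). Then ∑_{t=0}^{T−1} H_t ≤ 512·ℓ²·F/(δ²γ) + 256·T·σ²/δ² + 768·ℓ²·T·σ²/(δ²·γ²·n), and ∑_{t=1}^{T} E_t ≤ 2^{17}·ℓ²·F/(δ⁴·γ) + 2^{16}·T·σ²/δ⁴. -/
/-- Deterministic chaining core of the total-error lemma of the EControl
dual-averaging analysis. -/
theorem total_error_chaining (δ ℓ L σ F η γ : ℝ) (n T : ℕ)
    (hδ0 : 0 < δ) (hδ1 : δ ≤ 1) (hℓ : 0 < ℓ) (hL : 0 ≤ L)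
    (hσ : 0 ≤ σ) (hF : 0 ≤ F) (hn : 1 ≤ n) (hT : 2 ≤ T)
    (hη : η = δ / 12) (hγL : 2 * L ≤ γ) (hγℓ : 28 * ℓ / δ ≤ γ)
    (Eseq Hseq Dseq : ℕ → ℝ)
    (hE : ∀ t, 0 ≤ Eseq t) (hH : ∀ t, 0 ≤ Hseq t) (hD : ∀ t, 0 ≤ Dseq t)
    (hE0 : Eseq 0 = 0)
    (hA : ∑ t ∈ Finset.Icc 1 T, Eseq t ≤
      ((1 - δ) / η ^ 2) * ∑ t ∈ Finset.range T, Hseq t)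
    (hB : ∑ t ∈ Finset.range T, Hseq t ≤
      (32 * η ^ 4 / δ ^ 2) * ∑ t ∈ Finset.range (T - 1), Eseq t +
        (32 * ℓ ^ 2 / δ ^ 2) * ∑ t ∈ Finset.range (T - 1), Dseq t +
        64 * T * σ ^ 2 / δ ^ 2)
    (hC : ((γ - L) / 2) * ∑ t ∈ Finset.range T, Dseq t ≤
      F + (3 / (2 * γ)) * ∑ t ∈ Finset.range T,
        ((1 - δ) * Hseq t + η ^ 2 * Eseq t) + 3 * T * σ ^ 2 / (2 * γ * n)) :
    (∑ t ∈ Finset.range T, Hseq t ≤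
        512 * ℓ ^ 2 * F / (δ ^ 2 * γ) + 256 * T * σ ^ 2 / δ ^ 2 +
          768 * ℓ ^ 2 * T * σ ^ 2 / (δ ^ 2 * γ ^ 2 * n)) ∧
      ∑ t ∈ Finset.Icc 1 T, Eseq t ≤
        2 ^ 17 * ℓ ^ 2 * F / (δ ^ 4 * γ) + 2 ^ 16 * T * σ ^ 2 / δ ^ 4 := by
  have hγ : 0 < γ := lt_of_lt_of_le (by positivity) hγℓ
  have hnone : (1 : ℝ) ≤ n := by exact_mod_cast hn
  have hn0 : (0 : ℝ) < n := by linarith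
  have hη0 : 0 < η := by rw [hη]; positivity
  have h1 : ∑ t ∈ Finset.range T, Eseq t ≤ ∑ t ∈ Finset.Icc 1 T, Eseq t := by
    have h0 : ∑ t ∈ Finset.range T, Eseq t ≤ ∑ t ∈ insert 0 (Finset.Icc 1 T), Eseq t := by
      apply Finset.sum_le_sum_of_subset_of_nonneg
      · intro x hx
        simp only [Finset.mem_range, Finset.mem_insert, Finset.mem_Icc] at *
        omega
      · intro i _ _
        exact hE i
    rw [Finset.sum_insert (by simp), hE0, zero_add] at h0
    exact h0
  have h2 : ∑ t ∈ Finset.range (T - 1), Eseq t ≤ ∑ t ∈ Finset.range T, Eseq t :=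
    Finset.sum_le_sum_of_subset_of_nonneg
      (Finset.range_subset_range.2 (Nat.sub_le T 1)) (fun i _ _ => hE i)
  have h3 : ∑ t ∈ Finset.range (T - 1), Dseq t ≤ ∑ t ∈ Finset.range T, Dseq t :=
    Finset.sum_le_sum_of_subset_of_nonneg
      (Finset.range_subset_range.2 (Nat.sub_le T 1)) (fun i _ _ => hD i)
  have hh : 0 ≤ ∑ t ∈ Finset.range T, Hseq t := Finset.sum_nonneg (fun i _ => hH i)
  have hd : 0 ≤ ∑ t ∈ Finset.range T, Dseq t := Finset.sum_nonneg (fun i _ => hD i)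
  rw [Finset.sum_add_distrib, ← Finset.mul_sum, ← Finset.mul_sum] at hC
  generalize ∑ t ∈ Finset.range T, Hseq t = h at *
  generalize ∑ t ∈ Finset.range T, Dseq t = d at *
  generalize ∑ t ∈ Finset.range (T - 1), Dseq t = dprev at *
  generalize ∑ t ∈ Finset.range (T - 1), Eseq t = eprev at *
  generalize ∑ t ∈ Finset.range T, Eseq t = emid at *
  generalize ∑ t ∈ Finset.Icc 1 T, Eseq t = e at *
  have hT0 : (0 : ℝ) ≤ T := Nat.cast_nonneg T
  generalize (T : ℝ) = τ at *
  generalize (n : ℝ) = m at *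
  have hK : ℓ ^ 2 / (δ ^ 2 * γ ^ 2) ≤ 1 / 784 := by
    rw [div_le_iff₀ hδ0] at hγℓ
    rw [div_le_iff₀ (by positivity)]
    have : (28 * ℓ) ^ 2 ≤ (γ * δ) ^ 2 := pow_le_pow_left₀ (by positivity) hγℓ 2
    nlinarith
  have hA1 : η ^ 2 * e ≤ (1 - δ) * h := by
    calc η ^ 2 * e ≤ η ^ 2 * ((1 - δ) / η ^ 2 * h) := by gcongr
      _ = (1 - δ) * h := by field_simp
  have hA2 : (1 - δ) * h ≤ h := by nlinarith
  have hEB : 32 * η ^ 4 / δ ^ 2 * eprev ≤ 2 / 9 * h := by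
    calc 32 * η ^ 4 / δ ^ 2 * eprev ≤ 32 * η ^ 4 / δ ^ 2 * e := by gcongr; linarith
      _ = 2 / 9 * (η ^ 2 * e) := by rw [hη]; field_simp; ring_nf
      _ ≤ 2 / 9 * h := by linarith
  have hD1 : γ / 4 * d ≤ F + 3 / γ * h + 3 * τ * σ ^ 2 / (2 * γ * m) := by
    have a1 : γ / 4 * d ≤ (γ - L) / 2 * d := mul_le_mul_of_nonneg_right (by linarith) hd
    have a2 : 3 / (2 * γ) * ((1 - δ) * h + η ^ 2 * emid) ≤ 3 / (2 * γ) * (2 * h) := by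
      have : η ^ 2 * emid ≤ η ^ 2 * e := by gcongr
      gcongr
      linarith
    have a3 : 3 / (2 * γ) * (2 * h) = 3 / γ * h := by field_simp
    linarith
  have hD2 : 32 * ℓ ^ 2 / δ ^ 2 * dprev ≤ 128 * (ℓ ^ 2 * F / (δ ^ 2 * γ))
      + 384 * (ℓ ^ 2 / (δ ^ 2 * γ ^ 2)) * h
      + 192 * (ℓ ^ 2 * τ * σ ^ 2 / (δ ^ 2 * γ ^ 2 * m)) := by
    calc 32 * ℓ ^ 2 / δ ^ 2 * dprev ≤ 32 * ℓ ^ 2 / δ ^ 2 * d := by gcongr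
      _ = 128 * ℓ ^ 2 / (δ ^ 2 * γ) * (γ / 4 * d) := by field_simp; ring_nf
      _ ≤ 128 * ℓ ^ 2 / (δ ^ 2 * γ) * (F + 3 / γ * h + 3 * τ * σ ^ 2 / (2 * γ * m)) := by
        gcongr
      _ = _ := by field_simp; ring
  have hKh : ℓ ^ 2 / (δ ^ 2 * γ ^ 2) * h ≤ 1 / 784 * h := by gcongr
  have hf0 : 0 ≤ ℓ ^ 2 * F / (δ ^ 2 * γ) := by positivity
  have hs0 : 0 ≤ τ * σ ^ 2 / δ ^ 2 := by positivity
  have hv0 : 0 ≤ ℓ ^ 2 * τ * σ ^ 2 / (δ ^ 2 * γ ^ 2 * m) := by positivity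
  have e1 : 64 * τ * σ ^ 2 / δ ^ 2 = 64 * (τ * σ ^ 2 / δ ^ 2) := by ring
  have hmain : h ≤ 512 * (ℓ ^ 2 * F / (δ ^ 2 * γ)) + 256 * (τ * σ ^ 2 / δ ^ 2)
      + 768 * (ℓ ^ 2 * τ * σ ^ 2 / (δ ^ 2 * γ ^ 2 * m)) := by
    linarith
  refine ⟨le_trans hmain (le_of_eq (by ring)), ?_⟩
  have hv1 : ℓ ^ 2 * τ * σ ^ 2 / (δ ^ 2 * γ ^ 2 * m) ≤ 1 / 784 * (τ * σ ^ 2 / δ ^ 2) := by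
    calc ℓ ^ 2 * τ * σ ^ 2 / (δ ^ 2 * γ ^ 2 * m)
        = ℓ ^ 2 / (δ ^ 2 * γ ^ 2) * (τ * σ ^ 2 / m) := by field_simp
      _ ≤ 1 / 784 * (τ * σ ^ 2 / δ ^ 2) := by
        have : δ ^ 2 ≤ m := le_trans (pow_le_one₀ hδ0.le hδ1) hnone
        gcongr
  have hE2 : e ≤ 144 / δ ^ 2 * h := by
    calc e = 144 / δ ^ 2 * (η ^ 2 * e) := by rw [hη]; field_simp; ring_nf
      _ ≤ 144 / δ ^ 2 * h := by gcongr; linarith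
  calc e ≤ 144 / δ ^ 2 * h := hE2
    _ ≤ 144 / δ ^ 2 * (512 * (ℓ ^ 2 * F / (δ ^ 2 * γ)) + 257 * (τ * σ ^ 2 / δ ^ 2)) := by
      gcongr
      linarith
    _ ≤ 1 / δ ^ 2 * (2 ^ 17 * (ℓ ^ 2 * F / (δ ^ 2 * γ)) + 2 ^ 16 * (τ * σ ^ 2 / δ ^ 2)) := by
      rw [show (144 : ℝ) / δ ^ 2 = 1 / δ ^ 2 * 144 by ring, mul_assoc]
      gcongr
      linarith
    _ = _ := by field_simp
end
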